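/- Let G be a finite simple graph on a vertex set V whose edge set E is partitioned into pairwise disjoint sets E₁, …, E_c, and let G_i := (V, E_i). Let k, k′ ≥ 1 and, for each i, let H_i be a k′-connectivity certificate of G_i. Suppose that (a) for every S ⊆ V with |∂_G(S)| ≤ k one has |∂_{G_i}(S)| ≤ k′ for all i, and (b) for every S ⊆ V with ∅ ⊊ S ⊊ V and |∂_G(S)| > k one has Σ_{i=1}^{c} min(k′, |∂_{G_i}(S)|) ≥ k. Then H := H₁ ∪ … ∪ H_c is a k-connectivity certificate of G, i.e. for every S ⊆ V, min(k, |∂_H(S)|) = min(k, |∂_G(S)|). -/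

import Mathlib

open scoped Classical

/-- The edge boundary of a vertex set `S` in a simple graph `G`: the set of edges of `G`
with exactly one endpoint in `S`. -/
noncomputable def edgeBoundary {V : Type*} [Fintype V] (G : SimpleGraph V) (S : Finset V) :
    Finset (Sym2 V) :=
  Finset.univ.filter (fun e => e ∈ G.edgeSet ∧ ∃ v w, e = s(v, w) ∧ v ∈ S ∧ w ∉ S)

/-- `H` is a `k`-connectivity certificate of `G`: a subgraph of `G` preserving all cuts
of size at most `k`. -/
def IsConnCertificate {V : Type*} [Fintype V] (k : ℕ) (G H : SimpleGraph V) : Prop :=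
  H ≤ G ∧ ∀ S : Finset V, min k (edgeBoundary H S).card = min k (edgeBoundary G S).card

section edgeBoundary

variable {V : Type*} [Fintype V]

theorem mem_edgeBoundary {G : SimpleGraph V} {S : Finset V} {e : Sym2 V} :
    e ∈ edgeBoundary G S ↔ e ∈ G.edgeSet ∧ ∃ v w, e = s(v, w) ∧ v ∈ S ∧ w ∉ S := by
  simp [edgeBoundary]

theorem edgeBoundary_mono {G H : SimpleGraph V} (h : H ≤ G) (S : Finset V) :
    edgeBoundary H S ⊆ edgeBoundary G S := fun e he => by
  rw [mem_edgeBoundary] at he ⊢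
  exact ⟨SimpleGraph.edgeSet_mono h he.1, he.2⟩

theorem edgeBoundary_iSup {ι : Type*} [Fintype ι] (F : ι → SimpleGraph V) (S : Finset V) :
    edgeBoundary (⨆ i, F i) S = Finset.univ.biUnion fun i => edgeBoundary (F i) S := by
  ext e
  induction e with
  | _ x y =>
    simp only [mem_edgeBoundary, Finset.mem_biUnion, Finset.mem_univ, true_and,
      SimpleGraph.mem_edgeSet, SimpleGraph.iSup_adj, exists_and_right]

theorem card_edgeBoundary_iSup {ι : Type*} [Fintype ι] (F : ι → SimpleGraph V)
    (hF : ∀ i j, i ≠ j → Disjoint (F i).edgeSet (F j).edgeSet) (S : Finset V) :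
    (edgeBoundary (⨆ i, F i) S).card = ∑ i, (edgeBoundary (F i) S).card := by
  rw [edgeBoundary_iSup, Finset.card_biUnion]
  intro i _ j _ hij
  refine Finset.disjoint_left.2 fun e hi hj => ?_
  exact Set.disjoint_left.1 (hF i j hij) (mem_edgeBoundary.1 hi).1 (mem_edgeBoundary.1 hj).1

theorem nonempty_and_ne_univ_of_edgeBoundary_nonempty {G : SimpleGraph V} {S : Finset V}
    (h : (edgeBoundary G S).Nonempty) : S.Nonempty ∧ S ≠ Finset.univ := by
  obtain ⟨e, he⟩ := h
  obtain ⟨-, v, w, -, hv, hw⟩ := mem_edgeBoundary.1 he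
  exact ⟨⟨v, hv⟩, fun hS => hw (hS ▸ Finset.mem_univ w)⟩

end edgeBoundary

theorem colored_certificates_give_certificate
    {V : Type*} [Fintype V] (G : SimpleGraph V) (c : ℕ) (hc : 1 ≤ c)
    (Gi : Fin c → SimpleGraph V)
    (hpart : (⨆ i, Gi i) = G)
    (hdisj : ∀ i j, i ≠ j → Disjoint (Gi i).edgeSet (Gi j).edgeSet)
    (k k' : ℕ) (hk : 1 ≤ k) (hk' : 1 ≤ k')
    (Hi : Fin c → SimpleGraph V)
    (hHi : ∀ i, IsConnCertificate k' (Gi i) (Hi i))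
    (ha : ∀ S : Finset V, (edgeBoundary G S).card ≤ k →
      ∀ i, (edgeBoundary (Gi i) S).card ≤ k')
    (hb : ∀ S : Finset V, S.Nonempty → S ≠ Finset.univ → k < (edgeBoundary G S).card →
      k ≤ ∑ i, min k' (edgeBoundary (Gi i) S).card) :
    IsConnCertificate k G (⨆ i, Hi i) := by
  have hle : (⨆ i, Hi i) ≤ G := hpart ▸ iSup_mono fun i => (hHi i).1
  refine ⟨hle, fun S => ?_⟩
  have hH : (edgeBoundary (⨆ i, Hi i) S).card = ∑ i, (edgeBoundary (Hi i) S).card :=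
    card_edgeBoundary_iSup Hi (fun i j hij => (hdisj i j hij).mono
      (SimpleGraph.edgeSet_mono (hHi i).1) (SimpleGraph.edgeSet_mono (hHi j).1)) S
  have hG : (edgeBoundary G S).card = ∑ i, (edgeBoundary (Gi i) S).card :=
    hpart ▸ card_edgeBoundary_iSup Gi hdisj S
  rcases le_or_gt (edgeBoundary G S).card k with hS | hS
  · rw [hH, hG]
    congr 1
    refine Finset.sum_congr rfl fun i _ => ?_
    have h₁ := ha S hS i
    have h₂ := (hHi i).2 S
    have h₃ := Finset.card_le_card (edgeBoundary_mono (hHi i).1 S)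
    omega
  · obtain ⟨hne, huniv⟩ := nonempty_and_ne_univ_of_edgeBoundary_nonempty
      (Finset.card_pos.1 (Nat.zero_lt_of_lt hS))
    have hkH : k ≤ (edgeBoundary (⨆ i, Hi i) S).card :=
      calc k ≤ ∑ i, min k' (edgeBoundary (Gi i) S).card := hb S hne huniv hS
        _ = ∑ i, min k' (edgeBoundary (Hi i) S).card :=
          Finset.sum_congr rfl fun i _ => ((hHi i).2 S).symm
        _ ≤ ∑ i, (edgeBoundary (Hi i) S).card :=
          Finset.sum_le_sum fun i _ => min_le_right _ _
        _ = _ := hH.symm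
    rw [min_eq_left hkH, min_eq_left hS.le]
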